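/- Let K be any field and let x ∈ UU_n(K) be a unipotent upper triangular matrix such that all super-diagonal entries x_{i,i+1} (for 1 ≤ i ≤ n−1) are non-zero. Then the centralizer of x in UU_n(K) is abelian. -/

import Mathlib

def IsUU {n : ℕ} {K : Type*} [Field K] (A : Matrix (Fin n) (Fin n) K) : Prop :=
  (∀ i, A i i = 1) ∧ ∀ i j : Fin n, j < i → A i j = 0

theorem powRow {m : ℕ} {K : Type*} [Field K] (N : Matrix (Fin (m+1)) (Fin (m+1)) K)
    (h0 : ∀ i j : Fin (m+1), j ≤ i → N i j = 0)
    (h1 : ∀ i : Fin (m+1), ∀ h : (i : ℕ) + 1 < m+1, N i ⟨(i : ℕ) + 1, h⟩ ≠ 0) (k : ℕ) :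
    (∀ j : Fin (m+1), (j : ℕ) < k → (N ^ k) 0 j = 0) ∧
      ∀ j : Fin (m+1), (j : ℕ) = k → (N ^ k) 0 j ≠ 0 := by
  induction k with
  | zero =>
    refine ⟨fun j hj => by omega, fun j hj => ?_⟩
    have : j = 0 := Fin.ext hj
    subst this
    simp
  | succ k ih =>
    obtain ⟨ih1, ih2⟩ := ih
    refine ⟨fun j hj => ?_, fun j hj => ?_⟩
    · rw [pow_succ, Matrix.mul_apply]
      refine Finset.sum_eq_zero fun l _ => ?_
      by_cases hl : (l : ℕ) < k
      · rw [ih1 l hl, zero_mul]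
      · rw [h0 l j (by rw [Fin.le_def]; omega), mul_zero]
    · have hjm := j.isLt
      rw [pow_succ, Matrix.mul_apply, Finset.sum_eq_single (⟨k, by omega⟩ : Fin (m+1))]
      · refine mul_ne_zero (ih2 _ rfl) ?_
        have := h1 ⟨k, by omega⟩ (by simp only; omega)
        convert this
      · intro l _ hlk
        have hlk' : (l : ℕ) ≠ k := fun h => hlk (Fin.ext h)
        by_cases hl : (l : ℕ) < k
        · rw [ih1 l hl, zero_mul]
        · rw [h0 l j (by rw [Fin.le_def]; omega), mul_zero]
      · simp

theorem exists_poly {m : ℕ} {K : Type*} [Field K] (N g : Matrix (Fin (m+1)) (Fin (m+1)) K)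
    (h0 : ∀ i j : Fin (m+1), j ≤ i → N i j = 0)
    (h1 : ∀ i : Fin (m+1), ∀ h : (i : ℕ) + 1 < m+1, N i ⟨(i : ℕ) + 1, h⟩ ≠ 0)
    (hg : Commute g N) : ∃ a : Fin (m+1) → K, g = ∑ k, a k • N ^ (k : ℕ) := by
  let P : Matrix (Fin (m+1)) (Fin (m+1)) K := Matrix.of fun k j => (N ^ (k : ℕ)) 0 j
  have hdet : IsUnit P.det := by
    rw [isUnit_iff_ne_zero, Matrix.det_of_isUpperTriangular]
    · exact Finset.prod_ne_zero_iff.2 fun k _ => (powRow N h0 h1 k).2 k rfl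
    · intro i j hij
      exact (powRow N h0 h1 i).1 j hij
  let a : Fin (m+1) → K := Matrix.vecMul (g 0) P⁻¹
  have ha : Matrix.vecMul a P = g 0 := by
    simp only [a, Matrix.vecMul_vecMul, Matrix.nonsing_inv_mul P hdet, Matrix.vecMul_one]
  refine ⟨a, ?_⟩
  set c := g - ∑ k, a k • N ^ (k : ℕ) with hc
  have hcN : Commute c N := hg.sub_left
    (Commute.sum_left _ _ _ fun k _ => ((Commute.refl N).pow_left k).smul_left (a k))
  have hc0 : ∀ j, c 0 j = 0 := by
    intro j
    have := congrFun ha j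
    simp only [Matrix.vecMul, dotProduct, P, Matrix.of_apply] at this
    simp [hc, Matrix.sum_apply, ← this]
  have hPc : P * c = 0 := by
    ext k j
    have : (P * c) k j = (N ^ (k : ℕ) * c) 0 j := by simp [Matrix.mul_apply, P]
    rw [this, ← (hcN.pow_right k).eq, Matrix.mul_apply]
    simp [hc0]
  have : c = 0 := by
    rw [← Matrix.nonsing_inv_mul_cancel_left P c hdet, hPc, mul_zero]
  exact sub_eq_zero.1 this

theorem stmt6 {n : ℕ} {K : Type*} [Field K]
    (x : Matrix (Fin n) (Fin n) K) (hx : IsUU x)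
    (hsd : ∀ i : Fin n, ∀ h : (i : ℕ) + 1 < n, x i ⟨(i : ℕ) + 1, h⟩ ≠ 0) :
    ∀ g h : Matrix (Fin n) (Fin n) K, IsUU g → IsUU h →
      g * x = x * g → h * x = x * h → g * h = h * g := by
  intro g h _ _ hgx hhx
  cases n with
  | zero => exact Subsingleton.elim _ _
  | succ m =>
    have h0 : ∀ i j : Fin (m+1), j ≤ i → (x - 1) i j = 0 := by
      intro i j hij
      rcases hij.eq_or_lt with rfl | hlt
      · simp [hx.1]
      · simp [hx.2 i j hlt, Matrix.one_apply_ne hlt.ne']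
    have h1 : ∀ i : Fin (m+1), ∀ h : (i : ℕ) + 1 < m+1, (x - 1) i ⟨(i : ℕ) + 1, h⟩ ≠ 0 := by
      intro i hi
      have hne : i ≠ ⟨(i : ℕ) + 1, hi⟩ := by
        intro e
        have := congrArg Fin.val e
        simp at this
      rw [Matrix.sub_apply, Matrix.one_apply_ne hne, sub_zero]
      exact hsd i hi
    have hgN : Commute g (x - 1) := Commute.sub_right hgx (Commute.one_right g)
    have hhN : Commute h (x - 1) := Commute.sub_right hhx (Commute.one_right h)
    obtain ⟨a, ha⟩ := exists_poly (x - 1) g h0 h1 hgN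
    have : Commute g h := by
      rw [ha]
      exact Commute.sum_left _ _ _ fun k _ => (hhN.symm.pow_left k).smul_left (a k)
    exact this
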